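/- arXiv:2403.19437 — 2 statements merged into one kernel-verified Lean document; each statement's English description precedes it below -/
import Mathlib

section
/- Let (Ω, 𝒜, μ) be an atom-free σ-finite measure space and K ∈ (0, μ(Ω)). Define D := { d ∈ L^∞(Ω) : d ≥ 0, ‖d‖_∞ ≤ 1, ‖d‖_1 ≤ K }. Then the set of extreme points of the convex set D equals { χ_A : A ∈ 𝒜, μ(A) ≤ K }. -/
open MeasureTheory Set
open scoped ENNReal

/-- A measure is atom-free if no measurable set `A` with `μ A > 0` is an atom. -/
def AtomFree {Ω : Type*} [MeasurableSpace Ω] (μ : Measure Ω) : Prop :=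
  ∀ A : Set Ω, MeasurableSet A → 0 < μ A →
    ∃ B : Set Ω, MeasurableSet B ∧ B ⊆ A ∧ 0 < μ B ∧ 0 < μ (A \ B)

section

variable {Ω : Type*} [MeasurableSpace Ω] {μ : Measure Ω}

theorem eLpNorm_top_le_one_iff {f : Ω → ℝ} :
    eLpNorm f ∞ μ ≤ 1 ↔ ∀ᵐ x ∂μ, |f x| ≤ 1 := by
  rw [eLpNorm_exponent_top]
  constructor
  · intro h
    filter_upwards [enorm_ae_le_eLpNormEssSup f μ] with x hx
    have := hx.trans h
    rwa [← ofReal_norm, ENNReal.ofReal_le_one, Real.norm_eq_abs] at this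
  · intro h
    refine eLpNormEssSup_le_of_ae_enorm_bound ?_
    filter_upwards [h] with x hx
    rwa [← ofReal_norm, ENNReal.ofReal_le_one, Real.norm_eq_abs]

/-- The set of `d ∈ L^∞` with `0 ≤ d`, `‖d‖_∞ ≤ 1` and `‖d‖_1 ≤ K`. -/
def densitySet (μ : Measure Ω) (K : ℝ≥0∞) : Set (Lp ℝ ∞ μ) :=
  {d : Lp ℝ ∞ μ | (0 ≤ᵐ[μ] (d : Ω → ℝ)) ∧ eLpNorm (d : Ω → ℝ) ∞ μ ≤ 1 ∧
    (∫⁻ x, ‖(d : Ω → ℝ) x‖₊ ∂μ) ≤ K}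

theorem mem_densitySet_iff {K : ℝ≥0∞} {d : Lp ℝ ∞ μ} :
    d ∈ densitySet μ K ↔ (∀ᵐ x ∂μ, 0 ≤ d x ∧ d x ≤ 1) ∧ ∫⁻ x, ENNReal.ofReal (d x) ∂μ ≤ K := by
  have key (h : ∀ᵐ x ∂μ, 0 ≤ d x) :
      ∫⁻ x, (‖d x‖₊ : ℝ≥0∞) ∂μ = ∫⁻ x, ENNReal.ofReal (d x) ∂μ := by
    refine lintegral_congr_ae ?_
    filter_upwards [h] with x hx
    rw [← enorm_eq_nnnorm, Real.enorm_of_nonneg hx]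
  constructor
  · rintro ⟨h0, h1, h2⟩
    refine ⟨?_, (key h0).symm.trans_le h2⟩
    filter_upwards [h0, eLpNorm_top_le_one_iff.1 h1] with x hx0 hx1
    exact ⟨hx0, (abs_le.1 hx1).2⟩
  · rintro ⟨h, h2⟩
    have h0 : ∀ᵐ x ∂μ, 0 ≤ d x := h.mono fun x hx => hx.1
    refine ⟨h0, eLpNorm_top_le_one_iff.2 ?_, (key h0).trans_le h2⟩
    filter_upwards [h] with x hx
    exact abs_le.2 ⟨by linarith, hx.2⟩

theorem integrable_of_mem_densitySet {K : ℝ≥0∞} (hK : K ≠ ∞) {d : Lp ℝ ∞ μ}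
    (hd : d ∈ densitySet μ K) : Integrable d μ :=
  ⟨Lp.aestronglyMeasurable d, hd.2.2.trans_lt hK.lt_top⟩

theorem add_mem_densitySet {K : ℝ≥0∞} (hK : K ≠ ∞) {d g : Lp ℝ ∞ μ} (hd : d ∈ densitySet μ K)
    (hg : ∀ᵐ x ∂μ, |g x| ≤ min (d x) (1 - d x)) (hgi : Integrable g μ) (hg0 : ∫ x, g x ∂μ = 0) :
    d + g ∈ densitySet μ K := by
  have hdi := integrable_of_mem_densitySet hK hd
  rw [mem_densitySet_iff] at hd ⊢
  have hb : ∀ᵐ x ∂μ, 0 ≤ (d + g : Lp ℝ ∞ μ) x ∧ (d + g : Lp ℝ ∞ μ) x ≤ 1 := by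
    filter_upwards [hg, Lp.coeFn_add d g] with x hx hadd
    rw [hadd, Pi.add_apply]
    have := abs_le.1 (hx.trans (min_le_left _ _))
    have := abs_le.1 (hx.trans (min_le_right _ _))
    constructor <;> linarith
  refine ⟨hb, le_of_eq_of_le ?_ hd.2⟩
  have hsum : Integrable (d + g : Lp ℝ ∞ μ) μ := (hdi.add hgi).congr (Lp.coeFn_add d g).symm
  rw [← ofReal_integral_eq_lintegral_ofReal hsum (hb.mono fun x hx => hx.1),
    ← ofReal_integral_eq_lintegral_ofReal hdi (hd.1.mono fun x hx => hx.1),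
    integral_congr_ae (Lp.coeFn_add d g)]
  simp only [Pi.add_apply]
  rw [integral_add hdi hgi, hg0, add_zero]

theorem eq_zero_of_mem_extremePoints_densitySet {K : ℝ≥0∞} (hK : K ≠ ∞) {d g : Lp ℝ ∞ μ}
    (hd : d ∈ (densitySet μ K).extremePoints ℝ)
    (hg : ∀ᵐ x ∂μ, |g x| ≤ min (d x) (1 - d x)) (hgi : Integrable g μ) (hg0 : ∫ x, g x ∂μ = 0) :
    g = 0 := by
  have hp := add_mem_densitySet hK hd.1 hg hgi hg0
  have hm : d + -g ∈ densitySet μ K := by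
    refine add_mem_densitySet hK hd.1 ?_ (hgi.neg.congr (Lp.coeFn_neg g).symm) ?_
    · filter_upwards [hg, Lp.coeFn_neg g] with x hx hneg
      rwa [hneg, Pi.neg_apply, abs_neg]
    · rw [integral_congr_ae (Lp.coeFn_neg g)]
      simp only [Pi.neg_apply]
      rw [integral_neg, hg0, neg_zero]
  have := hd.2 hp hm ⟨1 / 2, 1 / 2, by norm_num, by norm_num, by norm_num, by module⟩
  simpa using this

theorem ae_eq_zero_or_one_of_mem_extremePoints (hμ : AtomFree μ) {K : ℝ≥0∞} (hK : K ≠ ∞)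
    {d : Lp ℝ ∞ μ} (hd : d ∈ (densitySet μ K).extremePoints ℝ) :
    ∀ᵐ x ∂μ, d x = 0 ∨ d x = 1 := by
  have hmeas : Measurable d := (Lp.stronglyMeasurable d).measurable
  have hbd := (mem_densitySet_iff.1 hd.1).1
  have hdi := integrable_of_mem_densitySet hK hd.1
  set h : Ω → ℝ := fun x => min (d x) (1 - d x) with h_def
  have hh : Measurable h := hmeas.min (measurable_const.sub hmeas)
  have hnn : ∀ᵐ x ∂μ, 0 ≤ h x := by
    filter_upwards [hbd] with x hx
    exact le_min hx.1 (by linarith [hx.2])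
  have hhi : Integrable h μ := by
    refine hdi.mono hh.aestronglyMeasurable ?_
    filter_upwards [hbd, hnn] with x hx hx'
    rw [Real.norm_of_nonneg hx', Real.norm_of_nonneg hx.1]
    exact min_le_left _ _
  set S : Set Ω := {x | 0 < h x} with S_def
  have hS : MeasurableSet S := measurableSet_lt measurable_const hh
  have hpos {B : Set Ω} (hB : MeasurableSet B) (hBS : B ⊆ S) (hB0 : 0 < μ B) :
      0 < ∫ x in B, h x ∂μ := by
    rw [setIntegral_pos_iff_support_of_nonneg_ae (ae_restrict_of_ae hnn) hhi.integrableOn]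
    have hsupp : B ⊆ Function.support h := fun x hx => ne_of_gt (hBS hx)
    rwa [inter_eq_right.2 hsupp]
  suffices hS0 : μ S = 0 by
    filter_upwards [hbd, measure_eq_zero_iff_ae_notMem.1 hS0] with x hx hxS
    by_contra! hne
    exact hxS (lt_min (hx.1.lt_of_ne' hne.1) (sub_pos.2 (hx.2.lt_of_ne hne.2)))
  by_contra hS0
  obtain ⟨B, hB, hBS, hB0, hC0⟩ := hμ S hS (pos_iff_ne_zero.2 hS0)
  have hC : MeasurableSet (S \ B) := hS.diff hB
  set b := ∫ x in B, h x ∂μ with b_def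
  set c := ∫ x in S \ B, h x ∂μ with c_def
  have hb : 0 < b := hpos hB hBS hB0
  have hc : 0 < c := hpos hC sdiff_subset hC0
  set g : Ω → ℝ := fun x =>
    B.indicator (fun x => c / (b + c) * h x) x - (S \ B).indicator (fun x => b / (b + c) * h x) x
    with g_def
  have hi₁ := (hhi.const_mul (c / (b + c))).indicator hB
  have hi₂ := (hhi.const_mul (b / (b + c))).indicator hC
  have hgi : Integrable g μ := hi₁.sub hi₂
  have hg0 : ∫ x, g x ∂μ = 0 := by
    rw [g_def, integral_sub hi₁ hi₂, integral_indicator hB, integral_indicator hC,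
      integral_const_mul, integral_const_mul, ← b_def, ← c_def]
    ring
  have hs : c / (b + c) ≤ 1 := (div_le_one (by positivity)).2 (by linarith)
  have ht : b / (b + c) ≤ 1 := (div_le_one (by positivity)).2 (by linarith)
  have hgh : ∀ᵐ x ∂μ, |g x| ≤ h x := by
    filter_upwards [hnn] with x hx
    by_cases hxB : x ∈ B
    · have : g x = c / (b + c) * h x := by simp [g_def, hxB]
      rw [this, abs_of_nonneg (by positivity)]
      exact mul_le_of_le_one_left hx hs
    by_cases hxS : x ∈ S
    · have : g x = -(b / (b + c) * h x) := by simp [g_def, hxB, hxS]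
      rw [this, abs_neg, abs_of_nonneg (by positivity)]
      exact mul_le_of_le_one_left hx ht
    · simpa [g_def, hxB, hxS] using hx
  have hgL : MemLp g ∞ μ := by
    refine memLp_top_of_bound hgi.aestronglyMeasurable 1 ?_
    filter_upwards [hgh, hbd] with x hx hx'
    exact hx.trans ((min_le_left _ _).trans hx'.2)
  have hgc := hgL.coeFn_toLp
  have hzero := eq_zero_of_mem_extremePoints_densitySet hK hd (g := hgL.toLp g)
    (by filter_upwards [hgh, hgc] with x hx hx'; rwa [hx'])
    (hgi.congr hgc.symm) ((integral_congr_ae hgc).trans hg0)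
  rw [Lp.eq_zero_iff_ae_eq_zero] at hzero
  refine hB0.ne' (measure_eq_zero_iff_ae_notMem.2 ?_)
  filter_upwards [hgc.symm.trans hzero] with x hx hxB
  have hgx : g x = c / (b + c) * h x := by simp [g_def, hxB]
  have hhx : 0 < h x := hBS hxB
  have : 0 < g x := hgx ▸ by positivity
  exact this.ne' hx

theorem lintegral_ofReal_of_ae_eq_indicator_one {f : Ω → ℝ} {A : Set Ω} (hA : MeasurableSet A)
    (hf : f =ᵐ[μ] A.indicator 1) : ∫⁻ x, ENNReal.ofReal (f x) ∂μ = μ A := by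
  rw [← lintegral_indicator_one hA]
  refine lintegral_congr_ae ?_
  filter_upwards [hf] with x hx
  by_cases hxA : x ∈ A <;> simp [hx, hxA]

theorem mem_extremePoints_densitySet_of_ae_eq_indicator {K : ℝ≥0∞} {d : Lp ℝ ∞ μ} {A : Set Ω}
    (hA : MeasurableSet A) (hAK : μ A ≤ K) (hd : d =ᵐ[μ] A.indicator (1 : Ω → ℝ)) :
    d ∈ (densitySet μ K).extremePoints ℝ := by
  refine ⟨mem_densitySet_iff.2 ⟨?_, ?_⟩, ?_⟩
  · filter_upwards [hd] with x hx
    by_cases hxA : x ∈ A <;> simp [hx, hxA]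
  · rwa [lintegral_ofReal_of_ae_eq_indicator_one hA hd]
  · rintro d₁ h₁ d₂ h₂ ⟨s, t, hs, ht, hst, hsum⟩
    refine Lp.ext ?_
    have hcoe : d =ᵐ[μ] s • ⇑d₁ + t • ⇑d₂ := by
      rw [← hsum]
      exact (Lp.coeFn_add _ _).trans ((Lp.coeFn_smul s d₁).add (Lp.coeFn_smul t d₂))
    filter_upwards [hd, hcoe, (mem_densitySet_iff.1 h₁).1, (mem_densitySet_iff.1 h₂).1]
      with x hx hx' hx₁ hx₂
    simp only [Pi.add_apply, Pi.smul_apply, smul_eq_mul] at hx'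
    by_cases hxA : x ∈ A
    · have : d x = 1 := by simp [hx, hxA]
      rw [this] at hx' ⊢
      nlinarith [mul_nonneg ht.le (sub_nonneg.2 hx₂.2)]
    · have : d x = 0 := by simp [hx, hxA]
      rw [this] at hx' ⊢
      nlinarith [mul_nonneg ht.le hx₂.1]

end

/-- in an atom-free σ-finite space with `K ∈ (0, μ(Ω))`, the extreme points of
`D = { d ∈ L^∞ : d ≥ 0, ‖d‖_∞ ≤ 1, ‖d‖_1 ≤ K }` are exactly the characteristic functions
`χ_A` of measurable sets `A` with `μ A ≤ K`. -/
theorem stmt7 {Ω : Type*} [MeasurableSpace Ω] (μ : Measure Ω) [SigmaFinite μ]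
    (hμ : AtomFree μ) (K : ℝ≥0∞) (hK0 : 0 < K) (hK : K < μ Set.univ) :
    Set.extremePoints ℝ
      {d : Lp ℝ ∞ μ | (0 ≤ᵐ[μ] (d : Ω → ℝ)) ∧ eLpNorm (d : Ω → ℝ) ∞ μ ≤ 1 ∧
        (∫⁻ x, ‖(d : Ω → ℝ) x‖₊ ∂μ) ≤ K} =
    {d : Lp ℝ ∞ μ | ∃ A : Set Ω, MeasurableSet A ∧ μ A ≤ K ∧
      (d : Ω → ℝ) =ᵐ[μ] A.indicator 1} := by
  ext d
  constructor
  · intro hd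
    change d ∈ (densitySet μ K).extremePoints ℝ at hd
    have hA : MeasurableSet {x | d x = 1} :=
      (Lp.stronglyMeasurable d).measurable (measurableSet_singleton 1)
    have hdA : d =ᵐ[μ] {x | d x = 1}.indicator (1 : Ω → ℝ) := by
      filter_upwards [ae_eq_zero_or_one_of_mem_extremePoints hμ hK.ne_top hd] with x hx
      rcases hx with hx | hx <;> simp [indicator, hx]
    refine ⟨_, hA, ?_, hdA⟩
    rw [← lintegral_ofReal_of_ae_eq_indicator_one hA hdA]
    exact (mem_densitySet_iff.1 hd.1).2
  · rintro ⟨A, hA, hAK, hdA⟩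
    exact mem_extremePoints_densitySet_of_ae_eq_indicator hA hAK hdA
end

section
/- Let (Ω, 𝒜, μ) be a finite atom-free measure space and K ∈ (0, μ(Ω)). Then for every u ∈ L^1(Ω), (K/μ(Ω)) ‖u‖_1 ≤ |u|_K ≤ ‖u‖_1; in particular |·|_K and ‖·‖_1 are equivalent norms on L^1(Ω). -/
open MeasureTheory Set
open scoped ENNReal

/-- The largest-K-norm: `|u|_K = sup { ∫_A |u| dμ : A measurable, μ(A) ≤ K }`. -/
noncomputable def largestK {Ω : Type*} [MeasurableSpace Ω] (μ : Measure Ω) (K : ℝ≥0∞)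
    (u : Ω → ℝ) : ℝ :=
  sSup {r : ℝ | ∃ A : Set Ω, MeasurableSet A ∧ μ A ≤ K ∧ r = ∫ x in A, |u x| ∂μ}

/-- A family of sets closed under increasing countable unions has a member whose measure cannot be
increased within the family by enlarging it. -/
lemma exists_measureReal_maximal {Ω : Type*} [MeasurableSpace Ω] (μ : Measure Ω)
    [IsFiniteMeasure μ] (P : Set Ω → Prop) (h0 : P ∅)
    (hU : ∀ f : ℕ → Set Ω, Monotone f → (∀ n, P (f n)) → P (⋃ n, f n)) :
    ∃ A, P A ∧ ∀ B, A ⊆ B → P B → μ.real B ≤ μ.real A := by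
  have step : ∀ (n : ℕ) (A : {A // P A}), ∃ B : {B // P B}, A.1 ⊆ B.1 ∧
      ∀ D, P D → A.1 ⊆ D → μ.real D ≤ μ.real B.1 + 1 / ((n : ℝ) + 1) := by
    intro n A
    let S : Set ℝ := {r | ∃ D, P D ∧ A.1 ⊆ D ∧ r = μ.real D}
    have hne : S.Nonempty := ⟨_, A.1, A.2, subset_rfl, rfl⟩
    have hbdd : BddAbove S := by
      refine ⟨μ.real univ, ?_⟩
      rintro r ⟨D, -, -, rfl⟩
      exact measureReal_mono (subset_univ _)
    obtain ⟨r, ⟨B, hB, hAB, rfl⟩, hr⟩ :=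
      exists_lt_of_lt_csSup hne (sub_lt_self (sSup S) (Nat.one_div_pos_of_nat (n := n)))
    refine ⟨⟨B, hB⟩, hAB, fun D hD hAD => ?_⟩
    have : μ.real D ≤ sSup S := le_csSup hbdd ⟨D, hD, hAD, rfl⟩
    linarith
  choose F hF hFmax using step
  let a : ℕ → {A // P A} := fun n => Nat.rec ⟨∅, h0⟩ F n
  have hmono : Monotone fun n => (a n).1 := monotone_nat_of_le_succ fun n => hF n (a n)
  refine ⟨⋃ n, (a n).1, hU _ hmono fun n => (a n).2, fun D hD hPD => ?_⟩
  refine le_of_forall_pos_le_add fun ε hε => ?_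
  obtain ⟨n, hn⟩ := exists_nat_one_div_lt hε
  have h1 := hFmax n (a n) D hPD ((subset_iUnion (fun n => (a n).1) n).trans hD)
  have h2 : μ.real (F n (a n)).1 ≤ μ.real (⋃ n, (a n).1) :=
    measureReal_mono (subset_iUnion (fun n => (a n).1) (n + 1))
  linarith

namespace AtomFree

variable {Ω : Type*} [MeasurableSpace Ω] {μ : Measure Ω}

lemma exists_subset_measureReal_le_div_two_pow [IsFiniteMeasure μ] (hμ : AtomFree μ) {E : Set Ω}
    (hE : MeasurableSet E) (hpos : 0 < μ E) (n : ℕ) :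
    ∃ B ⊆ E, MeasurableSet B ∧ 0 < μ B ∧ μ.real B ≤ μ.real E / 2 ^ n := by
  induction n with
  | zero => exact ⟨E, subset_rfl, hE, hpos, by simp⟩
  | succ n ih =>
    obtain ⟨B, hBE, hB, hB0, hle⟩ := ih
    obtain ⟨C, hC, hCB, hC0, hD0⟩ := hμ B hB hB0
    have hadd : μ.real (B \ C) = μ.real B - μ.real C := measureReal_sdiff hCB hC
    have hpow : μ.real E / 2 ^ (n + 1) = μ.real E / 2 ^ n / 2 := by rw [pow_succ, div_div]
    rcases le_total (μ.real C) (μ.real (B \ C)) with h | h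
    · exact ⟨C, hCB.trans hBE, hC, hC0, by linarith⟩
    · exact ⟨B \ C, sdiff_subset.trans hBE, hB.diff hC, hD0, by linarith⟩

lemma exists_subset_measureReal_le [IsFiniteMeasure μ] (hμ : AtomFree μ) {E : Set Ω}
    (hE : MeasurableSet E) (hpos : 0 < μ E) {ε : ℝ} (hε : 0 < ε) :
    ∃ B ⊆ E, MeasurableSet B ∧ 0 < μ B ∧ μ.real B ≤ ε := by
  obtain ⟨n, hn⟩ := pow_unbounded_of_one_lt (μ.real E / ε) one_lt_two
  obtain ⟨B, hBE, hB, hB0, hle⟩ := hμ.exists_subset_measureReal_le_div_two_pow hE hpos n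
  refine ⟨B, hBE, hB, hB0, hle.trans ?_⟩
  rw [div_le_iff₀ (by positivity), mul_comm]
  exact ((div_lt_iff₀ hε).1 hn).le

/-- Sierpiński's theorem: an atom-free finite measure takes all intermediate values. -/
theorem exists_subset_measureReal_eq [IsFiniteMeasure μ] (hμ : AtomFree μ) {E : Set Ω}
    (hE : MeasurableSet E) {t : ℝ} (ht0 : 0 ≤ t) (ht : t ≤ μ.real E) :
    ∃ B ⊆ E, MeasurableSet B ∧ μ.real B = t := by
  obtain ⟨A, ⟨hAE, hA, hAt⟩, hmax⟩ := exists_measureReal_maximal μ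
    (fun A => A ⊆ E ∧ MeasurableSet A ∧ μ.real A ≤ t) ⟨empty_subset _, .empty, by simpa⟩ (by
      intro f hf hP
      refine ⟨iUnion_subset fun n => (hP n).1, .iUnion fun n => (hP n).2.1, ?_⟩
      have hlim := (ENNReal.tendsto_toReal (measure_ne_top μ (⋃ n, f n))).comp
        (tendsto_measure_iUnion_atTop (μ := μ) hf)
      exact le_of_tendsto' hlim fun n => (hP n).2.2)
  refine ⟨A, hAE, hA, hAt.antisymm (le_of_not_gt fun hlt => ?_)⟩
  have hdiff : μ.real (E \ A) = μ.real E - μ.real A := measureReal_sdiff hAE hA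
  have hpos : 0 < μ (E \ A) := (ENNReal.toReal_pos_iff.1 (show 0 < μ.real (E \ A) by linarith)).1
  obtain ⟨B, hBE, hB, hB0, hBt⟩ :=
    hμ.exists_subset_measureReal_le (hE.diff hA) hpos (sub_pos.2 hlt)
  have hunion : μ.real (A ∪ B) = μ.real A + μ.real B :=
    measureReal_union (disjoint_sdiff_right.mono_right hBE) hB
  have hB0' : 0 < μ.real B := ENNReal.toReal_pos hB0.ne' (measure_ne_top μ B)
  have := hmax (A ∪ B) subset_union_left
    ⟨union_subset hAE (hBE.trans sdiff_subset), hA.union hB, by linarith⟩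
  linarith

/-- An integrable function of integral zero has nonnegative integral over some set of any prescribed
measure. -/
lemma exists_setIntegral_nonneg [IsFiniteMeasure μ] (hμ : AtomFree μ) {g : Ω → ℝ}
    (hg : Integrable g μ) (hg0 : ∫ x, g x ∂μ = 0) {t : ℝ} (ht0 : 0 ≤ t) (ht : t ≤ μ.real univ) :
    ∃ A, MeasurableSet A ∧ μ.real A = t ∧ 0 ≤ ∫ x in A, g x ∂μ := by
  have hgm := hg.aestronglyMeasurable
  have hae := hgm.ae_eq_mk
  let E : Set Ω := {x | 0 ≤ hgm.mk g x}
  have hE : MeasurableSet E := measurableSet_le measurable_const hgm.measurable_mk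
  rcases le_total t (μ.real E) with h | h
  · obtain ⟨A, hAE, hA, rfl⟩ := hμ.exists_subset_measureReal_eq hE ht0 h
    refine ⟨A, hA, rfl, setIntegral_nonneg_of_ae_restrict ?_⟩
    filter_upwards [ae_restrict_of_ae hae, ae_restrict_mem hA] with x hx hxA
    rw [hx]
    exact hAE hxA
  · have hEc : μ.real Eᶜ = μ.real univ - μ.real E := measureReal_compl hE
    obtain ⟨B, hBE, hB, hBt⟩ := hμ.exists_subset_measureReal_eq hE.compl
      (sub_nonneg.2 ht) (by linarith)
    refine ⟨Bᶜ, hB.compl, by rw [measureReal_compl hB, hBt]; ring, ?_⟩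
    have hneg : ∫ x in B, g x ∂μ ≤ 0 := by
      refine setIntegral_nonpos_of_ae_restrict ?_
      filter_upwards [ae_restrict_of_ae hae, ae_restrict_mem hB] with x hx hxB
      rw [hx]
      exact le_of_not_ge fun h => hBE hxB h
    have := integral_add_compl hB hg
    linarith

end AtomFree

/-- on a finite atom-free measure space with `K ∈ (0, μ(Ω))`, for every
`u ∈ L¹(Ω)` one has `(K/μ(Ω)) ‖u‖₁ ≤ |u|_K ≤ ‖u‖₁`, so `|·|_K` and `‖·‖₁` are
equivalent norms on `L¹(Ω)`. -/
theorem stmt9 {Ω : Type*} [MeasurableSpace Ω] (μ : Measure Ω) [IsFiniteMeasure μ]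
    (hμ : AtomFree μ) (K : ℝ≥0∞) (hK0 : 0 < K) (hK : K < μ Set.univ)
    (u : Ω → ℝ) (hu : Integrable u μ) :
    (K.toReal / (μ Set.univ).toReal) * ∫ x, |u x| ∂μ ≤ largestK μ K u ∧
    largestK μ K u ≤ ∫ x, |u x| ∂μ := by
  have hub : ∀ r ∈ {r : ℝ | ∃ A : Set Ω, MeasurableSet A ∧ μ A ≤ K ∧ r = ∫ x in A, |u x| ∂μ},
      r ≤ ∫ x, |u x| ∂μ := by
    rintro r ⟨A, -, -, rfl⟩
    exact setIntegral_le_integral hu.abs (ae_of_all _ fun x => abs_nonneg _)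
  refine ⟨?_, csSup_le ⟨_, ∅, .empty, by simp, rfl⟩ hub⟩
  have hm : 0 < μ.real univ := ENNReal.toReal_pos (hK0.trans hK).ne' (measure_ne_top μ _)
  set c : ℝ := (∫ x, |u x| ∂μ) / μ.real univ with hc
  have hg : Integrable (fun x => |u x| - c) μ := hu.abs.sub (integrable_const c)
  have hg0 : ∫ x, (|u x| - c) ∂μ = 0 := by
    rw [integral_sub hu.abs (integrable_const c), integral_const, smul_eq_mul, hc,
      mul_div_cancel₀ _ hm.ne', sub_self]
  obtain ⟨A, hA, hAK, hint⟩ := hμ.exists_setIntegral_nonneg hg hg0 K.toReal_nonneg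
    (ENNReal.toReal_mono (measure_ne_top μ _) hK.le)
  have hμA : μ A = K := (ENNReal.toReal_eq_toReal_iff' (measure_ne_top μ A) hK.ne_top).1 hAK
  rw [integral_sub hu.abs.integrableOn (integrable_const c), setIntegral_const, smul_eq_mul,
    hAK, sub_nonneg] at hint
  calc K.toReal / (μ univ).toReal * ∫ x, |u x| ∂μ = K.toReal * c :=
        (div_mul_eq_mul_div _ _ _).trans (mul_div_assoc _ _ _)
    _ ≤ ∫ x in A, |u x| ∂μ := hint
    _ ≤ largestK μ K u := le_csSup ⟨_, hub⟩ ⟨A, hA, hμA.le, rfl⟩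
end
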